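/- Let A and B be groups, let h be a non-elliptic element of the free product A * B (i.e. h is not conjugate to an element of the canonical image of A or of the canonical image of B), and let u ∈ A * B satisfy u h u⁻¹ = h⁻¹. Then u² = 1 and u is elliptic (conjugate to an element of the canonical image of A or of the canonical image of B). -/

import Mathlib

/-- An element of the free product `A ∗ B` is *elliptic* if it is conjugate to an element of
the canonical image of `A` or of the canonical image of `B`. -/
def IsElliptic {A B : Type*} [Group A] [Group B] (x : Monoid.Coprod A B) : Prop :=
  ∃ c : Monoid.Coprod A B,
    (∃ a : A, x = c * Monoid.Coprod.inl a * c⁻¹) ∨ (∃ b : B, x = c * Monoid.Coprod.inr b * c⁻¹)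

namespace Monoid.CoprodI

section ReducedLength

variable {ι : Type*} {M : ι → Type*} [∀ i, Monoid (M i)]

theorem NeWord.prod_eq_list_prod {i j : ι} (w : NeWord M i j) :
    w.prod = (w.toList.map fun x => of x.snd).prod := rfl

theorem NeWord.exists_toList_eq_cons {i j : ι} (w : NeWord M i j) :
    ∃ (a : M i) (l : List (Σ i, M i)), w.toList = ⟨i, a⟩ :: l :=
  ⟨w.head, List.head?_eq_some_iff.mp w.toList_head?⟩

theorem NeWord.exists_toList_eq_concat {i j : ι} (w : NeWord M i j) :
    ∃ (a : M j) (l : List (Σ i, M i)), w.toList = l ++ [⟨j, a⟩] :=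
  ⟨w.last, List.getLast?_eq_some_iff.mp w.toList_getLast?⟩

variable [∀ i, DecidableEq (M i)]

theorem Word.length_toList_rcons_le {i : ι} (p : Word.Pair M i) :
    (Word.rcons p).toList.length ≤ p.tail.toList.length + 1 := by
  unfold Word.rcons
  split <;> simp

theorem Word.length_toList_tail_le {i : ι} (p : Word.Pair M i) :
    p.tail.toList.length ≤ (Word.rcons p).toList.length := by
  unfold Word.rcons
  split <;> simp

variable [DecidableEq ι]

theorem Word.equiv_one : Word.equiv (1 : CoprodI M) = Word.empty :=
  Word.equiv.apply_symm_apply Word.empty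

theorem Word.equiv_of_mul {i : ι} (m : M i) (g : CoprodI M) :
    Word.equiv (of m * g) = of m • Word.equiv g := by
  refine (Word.equiv.symm_apply_eq.mp ?_).symm
  change Word.prod (of m • Word.equiv g) = of m * g
  rw [Word.prod_smul]
  exact congrArg (of m * ·) (Word.equiv.symm_apply_apply g)

/-- The number of letters in the reduced word representing an element of a free product. -/
def reducedLength (g : CoprodI M) : ℕ := (Word.equiv g).toList.length

theorem NeWord.equiv_prod {i j : ι} (w : NeWord M i j) : Word.equiv w.prod = w.toWord :=
  Word.equiv.apply_symm_apply w.toWord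

theorem NeWord.reducedLength_prod {i j : ι} (w : NeWord M i j) :
    reducedLength w.prod = w.toList.length := by
  rw [reducedLength, w.equiv_prod]
  rfl

theorem NeWord.toList_eq_of_prod_eq {i j k l : ι} {w : NeWord M i j} {w' : NeWord M k l}
    (h : w.prod = w'.prod) : w.toList = w'.toList := by
  have h' := congrArg Word.equiv h
  rw [w.equiv_prod, w'.equiv_prod] at h'
  exact congrArg Word.toList h'

theorem NeWord.fst_eq_of_prod_eq {i j k l : ι} {w : NeWord M i j} {w' : NeWord M k l}
    (h : w.prod = w'.prod) : i = k := by
  have h' := congrArg List.head? (NeWord.toList_eq_of_prod_eq h)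
  rw [w.toList_head?, w'.toList_head?] at h'
  exact congrArg Sigma.fst (Option.some.inj h')

theorem NeWord.snd_eq_of_prod_eq {i j k l : ι} {w : NeWord M i j} {w' : NeWord M k l}
    (h : w.prod = w'.prod) : j = l := by
  have h' := congrArg List.getLast? (NeWord.toList_eq_of_prod_eq h)
  rw [w.toList_getLast?, w'.toList_getLast?] at h'
  exact congrArg Sigma.fst (Option.some.inj h')

theorem NeWord.prod_ne_one {i j : ι} (w : NeWord M i j) : w.prod ≠ 1 := by
  intro h
  have h' := w.reducedLength_prod
  rw [h, reducedLength, Word.equiv_one] at h'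
  exact w.toList_ne_nil (List.length_eq_zero_iff.mp h'.symm)

theorem exists_neWord_prod_eq {g : CoprodI M} (hg : g ≠ 1) :
    ∃ (i j : ι) (w : NeWord M i j), g = w.prod := by
  have hne : Word.equiv g ≠ Word.empty := by
    intro h
    apply hg
    rw [← Word.equiv.symm_apply_apply g, h]
    rfl
  obtain ⟨i, j, w, hw⟩ := NeWord.of_word _ hne
  refine ⟨i, j, w, ?_⟩
  rw [NeWord.prod, hw]
  exact (Word.equiv.symm_apply_apply g).symm

theorem reducedLength_of_mul_le {i : ι} (m : M i) (g : CoprodI M) :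
    reducedLength (of m * g) ≤ reducedLength g + 1 := by
  rw [reducedLength, reducedLength, Word.equiv_of_mul, Word.of_smul_def]
  refine (Word.length_toList_rcons_le _).trans (Nat.succ_le_succ ?_)
  have h : Word.rcons (Word.equivPair i (Word.equiv g)) = Word.equiv g :=
    (Word.equivPair i).symm_apply_apply (Word.equiv g)
  exact (Word.length_toList_tail_le (Word.equivPair i (Word.equiv g))).trans_eq
    (congrArg (fun w => w.toList.length) h)

theorem reducedLength_list_prod_le (l : List (Σ i, M i)) :
    reducedLength (l.map fun x => of x.snd).prod ≤ l.length := by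
  induction l with
  | nil =>
    rw [List.map_nil, List.prod_nil, reducedLength, Word.equiv_one]
    rfl
  | cons x l ih =>
    rw [List.map_cons, List.prod_cons, List.length_cons]
    exact (reducedLength_of_mul_le _ _).trans (Nat.succ_le_succ ih)

theorem NeWord.reducedLength_mul_of_ne {i j k l : ι} (w : NeWord M i j) (w' : NeWord M k l)
    (h : j ≠ k) : reducedLength (w.prod * w'.prod) = w.toList.length + w'.toList.length := by
  rw [← NeWord.append_prod (hne := h), NeWord.reducedLength_prod, NeWord.toList,
    List.length_append]

theorem NeWord.reducedLength_mul_lt {i j l : ι} (w : NeWord M i j) (w' : NeWord M j l) :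
    reducedLength (w.prod * w'.prod) < w.toList.length + w'.toList.length := by
  obtain ⟨a, s, hs⟩ := w.exists_toList_eq_concat
  obtain ⟨b, t, ht⟩ := w'.exists_toList_eq_cons
  have h : w.prod * w'.prod = ((s ++ ⟨j, a * b⟩ :: t).map fun x => of x.snd).prod := by
    rw [w.prod_eq_list_prod, w'.prod_eq_list_prod, hs, ht]
    simp [mul_assoc]
  rw [h, hs, ht]
  refine (reducedLength_list_prod_le _).trans_lt ?_
  simp only [List.length_append, List.length_cons, List.length_nil]
  omega

/-- If `u` intertwines two reduced words of equal length, then its extreme letters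
are determined by those of the two words. -/
theorem NeWord.ends_of_intertwines {i j i' j' k l : ι} {w : NeWord M i j} {w' : NeWord M i' j'}
    {u : NeWord M k l} (hlen : w.toList.length = w'.toList.length)
    (h : u.prod * w.prod = w'.prod * u.prod) : (l = i ∧ k = j') ∨ (k = i' ∧ l = j) := by
  by_cases hl : l = i
  · subst hl
    refine Or.inl ⟨rfl, ?_⟩
    by_contra hk
    have h₁ := u.reducedLength_mul_lt w
    rw [h, w'.reducedLength_mul_of_ne u (Ne.symm hk)] at h₁
    omega
  · by_cases hk : j' = k
    · subst hk
      have h₁ := w'.reducedLength_mul_lt u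
      rw [← h, u.reducedLength_mul_of_ne w hl] at h₁
      omega
    · rw [← NeWord.append_prod (hne := hl), ← NeWord.append_prod (hne := hk)] at h
      exact Or.inr ⟨NeWord.fst_eq_of_prod_eq h, (NeWord.snd_eq_of_prod_eq h).symm⟩

end ReducedLength

section Group

variable {ι : Type*} {G : ι → Type*} [∀ i, Group (G i)]

theorem NeWord.length_toList_inv {i j : ι} (w : NeWord G i j) :
    w.inv.toList.length = w.toList.length := by
  induction w with
  | singleton x hx => rfl
  | append w₁ hne w₂ ih₁ ih₂ =>
    simp only [NeWord.inv, NeWord.toList, List.length_append, ih₁, ih₂]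
    omega

variable [DecidableEq ι] [∀ i, DecidableEq (G i)]

/-- Every element of a free product of groups is conjugate to an element of a factor or to a
cyclically reduced word. -/
theorem exists_conj_of_or_conj_neWord [Nonempty ι] (g : CoprodI G) :
    (∃ (c : CoprodI G) (i : ι) (a : G i), g = c * of a * c⁻¹) ∨
      ∃ (c : CoprodI G) (i j : ι) (_ : i ≠ j) (w : NeWord G i j), g = c * w.prod * c⁻¹ := by
  induction hn : reducedLength g using Nat.strong_induction_on generalizing g with
  | _ n ih =>
    by_cases hg : g = 1
    · obtain ⟨i⟩ := ‹Nonempty ι›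
      exact Or.inl ⟨1, i, 1, by simp [hg]⟩
    obtain ⟨i, j, w, rfl⟩ := exists_neWord_prod_eq hg
    by_cases hij : i = j
    swap
    · exact Or.inr ⟨1, i, j, hij, w, by simp⟩
    subst hij
    obtain ⟨a, l, hl⟩ := w.exists_toList_eq_cons
    rcases List.eq_nil_or_concat l with rfl | ⟨s, x, rfl⟩
    · exact Or.inl ⟨1, i, a, by simp [w.prod_eq_list_prod, hl]⟩
    obtain ⟨b, t, ht⟩ := w.exists_toList_eq_concat
    obtain rfl : x = ⟨i, b⟩ := by
      have h := hl.symm.trans ht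
      rw [List.concat_eq_append, ← List.cons_append] at h
      exact List.singleton_inj.mp (List.append_inj_right' h rfl)
    set g' : CoprodI G := ((s ++ [(⟨i, b * a⟩ : Σ i, G i)]).map fun x => of x.snd).prod with hg'
    have hconj : w.prod = of a * g' * (of a)⁻¹ := by
      rw [w.prod_eq_list_prod, hl, hg']
      simp [mul_assoc]
    have hlt : reducedLength g' < n := by
      rw [← hn, w.reducedLength_prod, hl]
      refine (reducedLength_list_prod_le _).trans_lt ?_
      simp
    rcases ih _ hlt g' rfl with ⟨c, k, d, hd⟩ | ⟨c, k, m, hkm, v, hv⟩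
    · exact Or.inl ⟨of a * c, k, d, by rw [hconj, hd]; group⟩
    · exact Or.inr ⟨of a * c, k, m, hkm, v, by rw [hconj, hv]; group⟩

/-- An element inverting a cyclically reduced word squares to one. -/
theorem NeWord.sq_eq_one_of_inverts {i j : ι} (hij : i ≠ j) (w : NeWord G i j) {u : CoprodI G}
    (h : u * w.prod * u⁻¹ = w.prod⁻¹) : u ^ 2 = 1 := by
  have hw : u * w.prod = w.inv.prod * u := by
    rw [NeWord.inv_prod, ← h]
    group
  have hcomm : u ^ 2 * w.prod = w.prod * u ^ 2 := by
    have h₁ : u * w.prod⁻¹ * u⁻¹ = w.prod := by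
      rw [← conj_inv, h, inv_inv]
    calc u ^ 2 * w.prod = u * (u * w.prod * u⁻¹) * u⁻¹ * u ^ 2 := by
          simp only [pow_two, mul_assoc, inv_mul_cancel_left,
            inv_mul_cancel, mul_one]
      _ = w.prod * u ^ 2 := by rw [h, h₁]
  by_contra hu₂
  have hu : u ≠ 1 := by
    rintro rfl
    exact hu₂ (one_pow 2)
  obtain ⟨k, l, v, rfl⟩ := exists_neWord_prod_eq hu
  obtain ⟨k', l', v', hv'⟩ := exists_neWord_prod_eq hu₂
  rw [hv'] at hcomm
  have hkl : k = l := by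
    rcases NeWord.ends_of_intertwines w.length_toList_inv.symm hw with ⟨h₁, h₂⟩ | ⟨h₁, h₂⟩
    · exact h₂.trans h₁.symm
    · exact h₁.trans h₂.symm
  have hkl' : k' ≠ l' := by
    rcases NeWord.ends_of_intertwines rfl hcomm with ⟨h₁, h₂⟩ | ⟨h₁, h₂⟩
    · rw [h₁, h₂]
      exact hij.symm
    · rwa [h₁, h₂]
  have hself : v.prod * v'.prod = v'.prod * v.prod := by
    rw [← hv', ← pow_succ, ← pow_succ']
  rcases NeWord.ends_of_intertwines rfl hself with ⟨h₁, h₂⟩ | ⟨h₁, h₂⟩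
  · exact hkl' (h₁.symm.trans (hkl.symm.trans h₂))
  · exact hkl' (h₁.symm.trans (hkl.trans h₂))

/-- An element of order dividing two in a free product of groups is conjugate into a factor. -/
theorem exists_conj_of_of_sq_eq_one [Nonempty ι] {u : CoprodI G} (hu : u ^ 2 = 1) :
    ∃ (c : CoprodI G) (i : ι) (a : G i), u = c * of a * c⁻¹ := by
  refine (exists_conj_of_or_conj_neWord u).resolve_right ?_
  rintro ⟨c, i, j, hij, w, rfl⟩
  rw [conj_pow, conj_eq_one_iff, pow_two, ← NeWord.append_prod (hne := hij.symm)] at hu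
  exact NeWord.prod_ne_one _ hu

/-- An element inverting an element not conjugate into a factor squares to one. -/
theorem sq_eq_one_of_inverts [Nonempty ι] {h u : CoprodI G}
    (hh : ¬ ∃ (c : CoprodI G) (i : ι) (a : G i), h = c * of a * c⁻¹)
    (hu : u * h * u⁻¹ = h⁻¹) : u ^ 2 = 1 := by
  obtain ⟨c, i, j, hij, w, rfl⟩ := (exists_conj_of_or_conj_neWord h).resolve_left hh
  have hv : (c⁻¹ * u * c) * w.prod * (c⁻¹ * u * c)⁻¹ = w.prod⁻¹ := by
    calc _ = c⁻¹ * (u * (c * w.prod * c⁻¹) * u⁻¹) * c := by group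
      _ = w.prod⁻¹ := by rw [hu]; group
  have h₂ := NeWord.sq_eq_one_of_inverts hij w hv
  calc u ^ 2 = c * (c⁻¹ * u * c) ^ 2 * c⁻¹ := by rw [pow_two, pow_two]; group
    _ = 1 := by rw [h₂]; group

end Group

end Monoid.CoprodI

namespace Monoid.Coprod

universe u v

variable (A : Type u) (B : Type v) [Group A] [Group B]

/-- The two factors of a binary free product as a family indexed by `Bool`. -/
def Factor : Bool → Type (max u v)
  | true => ULift.{v} A
  | false => ULift.{u} B

instance : ∀ b, Group (Factor A B b)
  | true => inferInstanceAs (Group (ULift.{v} A))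
  | false => inferInstanceAs (Group (ULift.{u} B))

/-- The inclusions of the factors into the binary free product. -/
def ofFactor : ∀ b, Factor A B b →* Monoid.Coprod A B
  | true => inl.comp (MulEquiv.ulift : ULift.{v} A ≃* A).toMonoidHom
  | false => inr.comp (MulEquiv.ulift : ULift.{u} B ≃* B).toMonoidHom

/-- A binary free product is the free product of the `Bool`-indexed family of its factors. -/
def equivCoprodI : Monoid.Coprod A B ≃* CoprodI (Factor A B) :=
  MonoidHom.toMulEquiv
    (lift ((CoprodI.of (M := Factor A B) (i := true)).comp
        (MulEquiv.ulift : ULift.{v} A ≃* A).symm.toMonoidHom)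
      ((CoprodI.of (M := Factor A B) (i := false)).comp
        (MulEquiv.ulift : ULift.{u} B ≃* B).symm.toMonoidHom))
    (CoprodI.lift (ofFactor A B))
    (by
      apply hom_ext <;> ext x
      · exact CoprodI.lift_of (ofFactor A B) (i := true) (ULift.up x)
      · exact CoprodI.lift_of (ofFactor A B) (i := false) (ULift.up x))
    (by
      apply CoprodI.ext_hom
      rintro (_ | _) <;> ext x <;> simp only [MonoidHom.comp_apply, CoprodI.lift_of] <;> rfl)

theorem equivCoprodI_symm_of {b : Bool} (x : Factor A B b) :
    (equivCoprodI A B).symm (CoprodI.of x) = ofFactor A B b x :=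
  CoprodI.lift_of (ofFactor A B) x

end Monoid.Coprod

theorem isElliptic_iff_equivCoprodI {A B : Type*} [Group A] [Group B] (x : Monoid.Coprod A B) :
    IsElliptic x ↔ ∃ (c : Monoid.CoprodI (Monoid.Coprod.Factor A B)) (b : Bool)
      (a : Monoid.Coprod.Factor A B b),
      Monoid.Coprod.equivCoprodI A B x = c * Monoid.CoprodI.of a * c⁻¹ := by
  constructor
  · rintro ⟨c, ⟨a, rfl⟩ | ⟨b, rfl⟩⟩
    · exact ⟨Monoid.Coprod.equivCoprodI A B c, true, ULift.up a, by
        rw [map_mul, map_mul, map_inv]; rfl⟩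
    · exact ⟨Monoid.Coprod.equivCoprodI A B c, false, ULift.up b, by
        rw [map_mul, map_mul, map_inv]; rfl⟩
  · rintro ⟨c, b, a, h⟩
    rw [← MulEquiv.eq_symm_apply, map_mul, map_mul, map_inv,
      Monoid.Coprod.equivCoprodI_symm_of] at h
    cases b
    · exact ⟨_, Or.inr ⟨a.down, h⟩⟩
    · exact ⟨_, Or.inl ⟨a.down, h⟩⟩

/-- An element of a free product that inverts a non-elliptic element by conjugation has order
dividing 2 and is elliptic. -/
theorem inverting_element_sq_eq_one_and_elliptic {A B : Type*} [Group A] [Group B]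
    (h u : Monoid.Coprod A B) (hh : ¬ IsElliptic h) (hu : u * h * u⁻¹ = h⁻¹) :
    u ^ 2 = 1 ∧ IsElliptic u := by
  classical
  have hv : Monoid.Coprod.equivCoprodI A B u * Monoid.Coprod.equivCoprodI A B h *
      (Monoid.Coprod.equivCoprodI A B u)⁻¹ = (Monoid.Coprod.equivCoprodI A B h)⁻¹ := by
    rw [← map_inv, ← map_inv, ← map_mul, ← map_mul, hu]
  rw [isElliptic_iff_equivCoprodI] at hh ⊢
  have hsq := Monoid.CoprodI.sq_eq_one_of_inverts hh hv
  refine ⟨?_, Monoid.CoprodI.exists_conj_of_of_sq_eq_one hsq⟩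
  rwa [← map_pow, MulEquiv.map_eq_one_iff] at hsq
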